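/- Suppose A acts by automorphisms on a finite group G, let B be a subnormal p-subgroup of A where p does not divide |G|, let C = C_G(B), and let C ≤ H ≤ G be an A-invariant subgroup. Let χ ∈ Irr_B(G) and let φ ∈ Irr_B(H) be the unique B-invariant irreducible constituent of χ_H whose multiplicity [χ_H, φ] is not divisible by p. Then the stabilizers A_χ and A_φ coincide. -/

import Mathlib

attribute [local instance] Classical.propDecidable

/-- The usual inner product of class functions/characters on a finite group. -/
noncomputable def innerChar (G : Type*) [Group G] [Fintype G] (α β : G → ℂ) : ℂ :=
  (Fintype.card G : ℂ)⁻¹ * ∑ g : G, α g * (starRingEnd ℂ) (β g)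

/-- `χ : G → ℂ` is the character of some finite-dimensional complex representation. -/
def IsChar (G : Type) [Group G] [Fintype G] (χ : G → ℂ) : Prop :=
  ∃ V : FDRep ℂ G, FDRep.character V = χ

/-- `χ` is an irreducible complex character of `G`. -/
def IsIrrChar (G : Type) [Group G] [Fintype G] (χ : G → ℂ) : Prop :=
  IsChar G χ ∧ innerChar G χ χ = 1

/-- `H` is a normal subgroup of `K` (in particular `H ≤ K`). -/
def normalIn {G : Type*} [Group G] (H K : Subgroup G) : Prop :=
  H ≤ K ∧ ∀ k ∈ K, ∀ h ∈ H, k * h * k⁻¹ ∈ H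

/-- `H` is subnormal in `K`: there is a chain `H = H₀ ⊴ H₁ ⊴ ⋯ ⊴ Hₙ = K`. -/
def subnormalIn {G : Type*} [Group G] (H K : Subgroup G) : Prop :=
  ∃ n : ℕ, ∃ f : Fin (n + 1) → Subgroup G,
    f 0 = H ∧ f (Fin.last n) = K ∧ ∀ i : Fin n, normalIn (f i.castSucc) (f i.succ)

open LinearMap in
/-- A linear endomorphism of finite order has an integral trace, and inverting it conjugates the
trace. -/
lemma trace_of_pow_eq_one {V : Type*} [AddCommGroup V] [Module ℂ V] [FiniteDimensional ℂ V]
    {f g : Module.End ℂ V} {n : ℕ} (hn : n ≠ 0) (hf : f ^ n = 1) (hgf : g * f = 1) :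
    trace ℂ V g = (starRingEnd ℂ) (trace ℂ V f) ∧ IsIntegral ℤ (trace ℂ V f) := by
  have hss : f.IsSemisimple := by
    refine Module.End.isSemisimple_of_squarefree_aeval_eq_zero
      (p := (Polynomial.X ^ n - Polynomial.C 1 : Polynomial ℂ)) ?_ (by simp [hf])
    exact (Polynomial.separable_X_pow_sub_C (1 : ℂ) (by exact_mod_cast hn) one_ne_zero).squarefree
  have hint : DirectSum.IsInternal f.eigenspace :=
    DirectSum.isInternal_submodule_of_iSupIndep_of_iSup_eq_top f.eigenspaces_iSupIndep
      hss.iSup_eigenspace_eq_top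
  have hgv : ∀ μ, ∀ v ∈ f.eigenspace μ, g v = μ⁻¹ • v := by
    intro μ v hv
    rw [Module.End.mem_eigenspace_iff] at hv
    have h1 : g (f v) = v := congr($hgf v)
    rw [hv, map_smul] at h1
    by_cases hμ : μ = 0
    · have : v = 0 := by simpa [hμ] using h1.symm
      simp [this]
    · rw [eq_inv_smul_iff₀ hμ, h1]
  have hfv : ∀ μ, ∀ v ∈ f.eigenspace μ, f v = μ • v := fun μ v hv ↦
    Module.End.mem_eigenspace_iff.1 hv
  have key : ∀ (e : Module.End ℂ V) (c : ℂ → ℂ), (∀ μ, ∀ v ∈ f.eigenspace μ, e v = c μ • v) →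
      ∃ s : Finset ℂ, (∀ μ, μ ∈ s ↔ f.eigenspace μ ≠ ⊥) ∧
        trace ℂ V e = ∑ μ ∈ s, c μ * (Module.finrank ℂ (f.eigenspace μ) : ℂ) := by
    intro e c he
    have hmaps : ∀ μ, Set.MapsTo e (f.eigenspace μ) (f.eigenspace μ) := fun μ v hv ↦ by
      rw [he μ v hv]; exact Submodule.smul_mem _ _ hv
    have hfin := WellFoundedGT.finite_ne_bot_of_iSupIndep hint.submodule_iSupIndep
    refine ⟨hfin.toFinset, by simp, ?_⟩
    rw [trace_eq_sum_trace_restrict' hint hfin hmaps]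
    refine Finset.sum_congr rfl fun μ _ ↦ ?_
    have : e.restrict (hmaps μ) = c μ • LinearMap.id := by
      ext v
      exact he μ v v.2
    rw [this, map_smul, trace_id, smul_eq_mul]
  obtain ⟨s, hs, hsf⟩ := key f (fun μ ↦ μ) hfv
  obtain ⟨t, ht, htg⟩ := key g _ hgv
  obtain rfl : s = t := by ext μ; rw [hs, ht]
  have hroot : ∀ μ ∈ s, μ ^ n = 1 := by
    intro μ hμ
    obtain ⟨v, hv, hv0⟩ := Submodule.exists_mem_ne_zero_of_ne_bot ((hs μ).1 hμ)
    have h1 : ∀ k : ℕ, (f ^ k) v = μ ^ k • v := by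
      intro k
      induction k with
      | zero => simp
      | succ k ih => rw [pow_succ, Module.End.mul_apply, hfv μ v hv, map_smul, ih, smul_smul,
          pow_succ']
    have h2 := h1 n
    rw [hf, Module.End.one_apply] at h2
    have h3 : (μ ^ n - 1) • v = 0 := by rw [sub_smul, ← h2, one_smul, sub_self]
    exact sub_eq_zero.1 ((smul_eq_zero.1 h3).resolve_right hv0)
  constructor
  · rw [htg, hsf, map_sum]
    refine Finset.sum_congr rfl fun μ hμ ↦ ?_
    rw [map_mul, map_natCast, Complex.inv_eq_conj (Complex.norm_eq_one_of_pow_eq_one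
      (hroot μ hμ) hn)]
  · rw [hsf]
    refine IsIntegral.sum _ fun μ hμ ↦ IsIntegral.mul ?_ (isIntegral_natCast _)
    exact IsIntegral.of_pow (Nat.pos_of_ne_zero hn) (by rw [hroot μ hμ]; exact isIntegral_one)

section Characters

open CategoryTheory

variable {G : Type} [Group G] [Fintype G]

lemma IsChar.apply_inv {χ : G → ℂ} (hχ : IsChar G χ) (g : G) :
    χ g⁻¹ = (starRingEnd ℂ) (χ g) := by
  obtain ⟨V, rfl⟩ := hχ
  refine (trace_of_pow_eq_one (n := Fintype.card G) Fintype.card_ne_zero ?_ ?_).1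
  · rw [← map_pow, pow_card_eq_one, map_one]
  · rw [← map_mul, inv_mul_cancel, map_one]

lemma IsChar.isIntegral {χ : G → ℂ} (hχ : IsChar G χ) (g : G) : IsIntegral ℤ (χ g) := by
  obtain ⟨V, rfl⟩ := hχ
  refine (trace_of_pow_eq_one (g := V.ρ g⁻¹) (n := Fintype.card G) Fintype.card_ne_zero ?_ ?_).2
  · rw [← map_pow, pow_card_eq_one, map_one]
  · rw [← map_mul, inv_mul_cancel, map_one]

lemma IsChar.apply_conj {χ : G → ℂ} (hχ : IsChar G χ) (g h : G) : χ (h * g * h⁻¹) = χ g := by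
  obtain ⟨V, rfl⟩ := hχ
  exact V.char_conj g h

lemma IsChar.of_representation {V : Type} [AddCommGroup V] [Module ℂ V] [FiniteDimensional ℂ V]
    (ρ : Representation ℂ G V) : IsChar G ρ.character :=
  ⟨FDRep.of ρ, rfl⟩

lemma IsChar.comp {K : Type} [Group K] [Fintype K] {χ : G → ℂ} (hχ : IsChar G χ) (f : K →* G) :
    IsChar K (fun k ↦ χ (f k)) := by
  obtain ⟨V, rfl⟩ := hχ
  exact ⟨FDRep.of (V.ρ.comp f), rfl⟩

lemma IsChar.innerChar_eq {α β : G → ℂ} (hβ : IsChar G β) :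
    innerChar G α β = (Fintype.card G : ℂ)⁻¹ * ∑ g : G, α g * β g⁻¹ := by
  simp_rw [innerChar, hβ.apply_inv]

lemma IsChar.exists_natCast_innerChar {α β : G → ℂ} (hα : IsChar G α) (hβ : IsChar G β) :
    ∃ m : ℕ, innerChar G α β = m := by
  rw [hβ.innerChar_eq]
  obtain ⟨V, rfl⟩ := hα
  obtain ⟨W, rfl⟩ := hβ
  have : Invertible (Nat.card G : ℂ) := invertibleOfNonzero (NeZero.ne _)
  refine ⟨Module.finrank ℂ (W ⟶ V), ?_⟩
  rw [← FDRep.scalar_product_char_eq_finrank_equivariant W V, Nat.card_eq_fintype_card]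

lemma innerChar_conj_symm (α β : G → ℂ) :
    (starRingEnd ℂ) (innerChar G α β) = innerChar G β α := by
  simp [innerChar, map_sum, mul_comm]

lemma IsChar.innerChar_comm {α β : G → ℂ} (hα : IsChar G α) (hβ : IsChar G β) :
    innerChar G α β = innerChar G β α := by
  obtain ⟨m, hm⟩ := hα.exists_natCast_innerChar hβ
  rw [← innerChar_conj_symm α β, hm, map_natCast]

lemma IsIrrChar.innerChar_eq_zero {α β : G → ℂ} (hα : IsIrrChar G α) (hβ : IsIrrChar G β)
    (hne : α ≠ β) : innerChar G α β = 0 := by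
  have hsimple : ∀ V : FDRep ℂ G, IsIrrChar G V.character → CategoryTheory.Simple V := by
    intro V hV
    rw [FDRep.simple_iff_char_is_norm_one]
    have h := hV.2
    rwa [hV.1.innerChar_eq, inv_mul_eq_one₀ (by simp), eq_comm, ← Nat.card_eq_fintype_card] at h
  obtain ⟨⟨V, rfl⟩, -⟩ := id hα
  obtain ⟨⟨W, rfl⟩, -⟩ := id hβ
  have := hsimple V hα
  have := hsimple W hβ
  have : Invertible (Nat.card G : ℂ) := invertibleOfNonzero (NeZero.ne _)
  rw [hβ.1.innerChar_eq, ← Nat.card_eq_fintype_card, FDRep.char_orthonormal, if_neg]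
  rintro ⟨i⟩
  exact hne (FDRep.char_iso i)

lemma Representation.isIrrChar_character {V : Type} [AddCommGroup V] [Module ℂ V]
    [FiniteDimensional ℂ V] (ρ : Representation ℂ G V) [ρ.IsIrreducible] :
    IsIrrChar G ρ.character := by
  have hρ := IsChar.of_representation ρ
  refine ⟨hρ, ?_⟩
  have : Invertible (Nat.card G : ℂ) := invertibleOfNonzero (NeZero.ne _)
  rw [hρ.innerChar_eq, ← Nat.card_eq_fintype_card, Representation.char_orthonormal,
    if_pos ⟨Representation.Equiv.refl _⟩]

lemma innerChar_comp_mulEquiv {K : Type} [Group K] [Fintype K] (e : K ≃* G) (α β : G → ℂ) :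
    innerChar K (fun k ↦ α (e k)) (fun k ↦ β (e k)) = innerChar G α β := by
  rw [innerChar, innerChar, Fintype.card_congr e.toEquiv]
  congr 1
  exact Fintype.sum_equiv e.toEquiv _ _ fun _ ↦ rfl

lemma IsIrrChar.comp_mulEquiv {K : Type} [Group K] [Fintype K] {χ : G → ℂ} (hχ : IsIrrChar G χ)
    (e : K ≃* G) : IsIrrChar K (fun k ↦ χ (e k)) := by
  refine ⟨hχ.1.comp e.toMonoidHom, ?_⟩
  rw [innerChar_comp_mulEquiv, hχ.2]

lemma innerChar_sum_smul {ι : Type*} (s : Finset ι) (c : ι → ℂ) (F : ι → G → ℂ) (β : G → ℂ) :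
    innerChar G (∑ i ∈ s, c i • F i) β = ∑ i ∈ s, c i * innerChar G (F i) β := by
  simp only [innerChar, Finset.sum_apply, Pi.smul_apply, smul_eq_mul, Finset.sum_mul,
    Finset.mul_sum]
  rw [Finset.sum_comm]
  refine Finset.sum_congr rfl fun _ _ ↦ Finset.sum_congr rfl fun _ _ ↦ by ring

lemma innerChar_sub_left (α α' β : G → ℂ) :
    innerChar G (α - α') β = innerChar G α β - innerChar G α' β := by
  simp [innerChar, sub_mul, Finset.sum_sub_distrib, mul_sub]

end Characters

section Completeness

variable {G : Type} [Group G] [Fintype G]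

/-- A class function orthogonal to all irreducible characters acts as zero on every
representation. -/
lemma Representation.sum_smul_inv_eq_zero {f : G → ℂ} (hf : ∀ g h, f (h * g * h⁻¹) = f g)
    (horth : ∀ φ, IsIrrChar G φ → innerChar G f φ = 0) (n : ℕ) :
    ∀ {V : Type} [AddCommGroup V] [Module ℂ V] [FiniteDimensional ℂ V]
      (ρ : Representation ℂ G V), Module.finrank ℂ V = n → ∑ g, f g • ρ g⁻¹ = 0 := by
  induction n using Nat.strong_induction_on with
  | _ n ih =>
  intro V _ _ _ ρ hn
  set T : V →ₗ[ℂ] V := ∑ g, f g • ρ g⁻¹ with hT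
  by_cases hirr : ρ.IsIrreducible
  · have hcomm : ∀ h, T ∘ₗ ρ h = ρ h ∘ₗ T := by
      intro h
      change T * ρ h = ρ h * T
      simp only [hT, Finset.sum_mul, Finset.mul_sum]
      refine Fintype.sum_equiv (MulAut.conj h⁻¹).toEquiv _ _ fun g ↦ ?_
      have h1 : f (h⁻¹ * g * h) = f g := by simpa using hf g h⁻¹
      have h2 : ρ g⁻¹ * ρ h = ρ h * ρ (h⁻¹ * g * h)⁻¹ := by
        rw [← map_mul, ← map_mul]
        congr 1
        group
      change (f g • ρ g⁻¹) * ρ h = ρ h * (f (h⁻¹ * g * h⁻¹⁻¹) • ρ (h⁻¹ * g * h⁻¹⁻¹)⁻¹)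
      rw [inv_inv, h1, smul_mul_assoc, mul_smul_comm, h2]
    let T' : ρ.IntertwiningMap ρ := ⟨T, hcomm⟩
    obtain ⟨c, hc⟩ :=
      (Representation.IsIrreducible.algebraMap_intertwiningMap_bijective_of_isAlgClosed (ρ := ρ)).2 T'
    have hTc : T = c • LinearMap.id := by
      have := congr(Representation.IntertwiningMap.toLinearMap $hc)
      exact this.symm
    have htr : LinearMap.trace ℂ V T = 0 := by
      have h0 := horth _ ρ.isIrrChar_character
      rw [(IsChar.of_representation ρ).innerChar_eq] at h0
      have h1 := (mul_eq_zero.1 h0).resolve_left (by simp)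
      rw [hT, map_sum, ← h1]
      simp [Representation.character]
    rw [hTc, map_smul, LinearMap.trace_id, smul_eq_mul, mul_eq_zero] at htr
    obtain rfl | h0 := htr
    · rw [hTc, zero_smul]
    · have : Subsingleton V := Module.finrank_zero_iff.1 (by exact_mod_cast h0)
      exact Subsingleton.elim _ _
  · by_cases hV : Subsingleton V
    · exact Subsingleton.elim _ _
    have hred : ∃ W : Subrepresentation ρ, W ≠ ⊥ ∧ W ≠ ⊤ := by
      by_contra! hcon
      refine hirr { exists_pair_ne := ⟨⊥, ⊤, ?_⟩, eq_bot_or_eq_top := fun W ↦ ?_ }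
      · intro h
        rw [not_subsingleton_iff_nontrivial] at hV
        exact bot_ne_top (α := Submodule ℂ V) congr(($h).toSubmodule)
      · exact or_iff_not_imp_left.2 (hcon W)
    obtain ⟨W, hW0, hW1⟩ := hred
    obtain ⟨W', hWW'⟩ := exists_isCompl W
    have hcompl : ∀ U : Subrepresentation ρ, U ≠ ⊤ → ∀ v ∈ U, T v = 0 := by
      intro U hU v hv
      have hlt : Module.finrank ℂ U.toSubmodule < n := by
        rw [← hn]
        refine Submodule.finrank_lt fun h ↦ hU ?_
        exact Subrepresentation.toSubmodule_injective h
      have h := congr(($(ih _ hlt U.toRepresentation rfl) ⟨v, hv⟩ : V))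
      simp only [LinearMap.sum_apply, LinearMap.smul_apply, AddSubmonoidClass.coe_finsetSum,
        Submodule.coe_smul] at h
      simp only [hT, LinearMap.sum_apply, LinearMap.smul_apply]
      exact h
    have hW1' : W' ≠ ⊤ := by
      rintro rfl
      exact hW0 (by simpa using hWW'.inf_eq_bot)
    ext v
    have hv : v ∈ W ⊔ W' := by rw [hWW'.sup_eq_top]; trivial
    obtain ⟨w, hw, w', hw', rfl⟩ := Submodule.mem_sup.1 hv
    rw [map_add, hcompl W hW1 w hw, hcompl W' hW1' w' hw']
    simp

lemma eq_zero_of_forall_innerChar_eq_zero {f : G → ℂ} (hf : ∀ g h, f (h * g * h⁻¹) = f g)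
    (horth : ∀ φ, IsIrrChar G φ → innerChar G f φ = 0) : f = 0 := by
  let ρ : Representation ℂ G (G → ℂ) :=
    { toFun := fun g ↦ LinearMap.funLeft ℂ ℂ (· * g)
      map_one' := by ext; simp [LinearMap.funLeft_apply]
      map_mul' := fun g h ↦ by ext; simp [LinearMap.funLeft_apply, mul_assoc] }
  have h := Representation.sum_smul_inv_eq_zero hf horth _ ρ rfl
  ext x
  have h1 := congr($h (Pi.single 1 1) x)
  simpa [ρ, LinearMap.sum_apply, Finset.sum_apply, LinearMap.funLeft_apply, Pi.single_apply,
    mul_inv_eq_one] using h1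

lemma linearIndependent_isIrrChar :
    LinearIndependent ℂ (fun φ : {φ : G → ℂ // IsIrrChar G φ} ↦ (φ : G → ℂ)) := by
  rw [linearIndependent_iff']
  intro s c hc φ hφ
  have h : innerChar G (∑ i ∈ s, c i • (i : G → ℂ)) φ = c φ := by
    rw [innerChar_sum_smul, Finset.sum_eq_single φ, φ.2.2, mul_one]
    · intro i _ hi
      rw [i.2.innerChar_eq_zero φ.2 (fun h ↦ hi (Subtype.ext h)), mul_zero]
    · exact fun h ↦ absurd hφ h
  rw [← h, hc]
  simp [innerChar]

lemma finite_setOf_isIrrChar (G : Type) [Group G] [Fintype G] :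
    {φ : G → ℂ | IsIrrChar G φ}.Finite :=
  linearIndependent_isIrrChar.finite

/-- The irreducible characters of `G`. -/
noncomputable def irrChars (G : Type) [Group G] [Fintype G] : Finset (G → ℂ) :=
  (finite_setOf_isIrrChar G).toFinset

lemma mem_irrChars {φ : G → ℂ} : φ ∈ irrChars G ↔ IsIrrChar G φ := by
  simp [irrChars]

lemma eq_sum_innerChar_mul {f : G → ℂ} (hf : ∀ g h, f (h * g * h⁻¹) = f g) (g : G) :
    f g = ∑ φ ∈ irrChars G, innerChar G f φ * φ g := by
  suffices f - ∑ φ ∈ irrChars G, innerChar G f φ • φ = 0 by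
    simpa [sub_eq_zero] using congr_fun this g
  refine eq_zero_of_forall_innerChar_eq_zero ?_ fun ψ hψ ↦ ?_
  · intro g h
    simp only [Pi.sub_apply, hf, Finset.sum_apply, Pi.smul_apply]
    congr 1
    refine Finset.sum_congr rfl fun φ hφ ↦ ?_
    rw [(mem_irrChars.1 hφ).1.apply_conj]
  · rw [innerChar_sub_left, innerChar_sum_smul, Finset.sum_eq_single ψ, hψ.2, mul_one, sub_self]
    · intro φ hφ hne
      rw [(mem_irrChars.1 hφ).innerChar_eq_zero hψ hne, mul_zero]
    · exact fun h ↦ absurd (mem_irrChars.2 hψ) h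

/-- Parseval's identity for class functions. -/
lemma innerChar_eq_sum_mul {f f' : G → ℂ} (hf : ∀ g h, f (h * g * h⁻¹) = f g) :
    innerChar G f f' = ∑ φ ∈ irrChars G, innerChar G f φ * innerChar G φ f' := by
  rw [← innerChar_sum_smul (F := fun φ ↦ φ)]
  congr 1
  ext g
  simpa using eq_sum_innerChar_mul hf g

end Completeness

section Congruence

variable {p : ℕ}

/-- The complex numbers of the form `p * z` with `z` an algebraic integer. -/
def integralMultiples (p : ℕ) : AddSubgroup ℂ where
  carrier := {x | ∃ z, IsIntegral ℤ z ∧ x = p * z}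
  zero_mem' := ⟨0, isIntegral_zero, by simp⟩
  add_mem' := by
    rintro _ _ ⟨z, hz, rfl⟩ ⟨w, hw, rfl⟩
    exact ⟨z + w, hz.add hw, by ring⟩
  neg_mem' := by
    rintro _ ⟨z, hz, rfl⟩
    exact ⟨-z, hz.neg, by ring⟩

lemma mul_mem_integralMultiples {x y : ℂ} (hx : IsIntegral ℤ x)
    (hy : y ∈ integralMultiples p) : x * y ∈ integralMultiples p := by
  obtain ⟨z, hz, rfl⟩ := hy
  exact ⟨x * z, hx.mul hz, by ring⟩

lemma mem_integralMultiples_of_sub {x y : ℂ} (h : x - y ∈ integralMultiples p)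
    (hy : y ∈ integralMultiples p) : x ∈ integralMultiples p := by
  simpa using add_mem h hy

lemma natCast_mem_integralMultiples (hp : p ≠ 0) {n : ℕ} :
    (n : ℂ) ∈ integralMultiples p ↔ p ∣ n := by
  constructor
  · rintro ⟨z, hz, h⟩
    have hzq : z = algebraMap ℚ ℂ (n / p) := by
      have : (p : ℂ) ≠ 0 := by exact_mod_cast hp
      simp only [map_div₀, map_natCast]
      field_simp
      rw [h, mul_comm]
    rw [hzq, isIntegral_algebraMap_iff (algebraMap ℚ ℂ).injective,
      IsIntegrallyClosed.isIntegral_iff] at hz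
    obtain ⟨m, hm⟩ := hz
    have hp' : (p : ℚ) ≠ 0 := by exact_mod_cast hp
    rw [eq_div_iff hp'] at hm
    have h1 : m * p = n := by
      have : ((m * p : ℤ) : ℚ) = (n : ℤ) := by push_cast; simpa using hm
      exact_mod_cast this
    exact Int.natCast_dvd_natCast.1 ⟨m, by rw [← h1, mul_comm]⟩
  · rintro ⟨m, rfl⟩
    exact ⟨m, isIntegral_natCast m, by push_cast; rfl⟩

/-- Modulo `p`, the sum of an invariant function over a set acted on by a `p`-group is the sum over
the fixed points. -/
lemma IsPGroup.sum_sub_sum_fixed_mem [Fact p.Prime] {P α : Type*} [Group P] [MulAction P α]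
    (hP : IsPGroup p P) (s : Finset α) (hs : ∀ b : P, ∀ a ∈ s, b • a ∈ s) {f : α → ℂ}
    (hf : ∀ b : P, ∀ a ∈ s, f (b • a) = f a) (hint : ∀ a ∈ s, IsIntegral ℤ (f a)) :
    ∑ a ∈ s, f a - ∑ a ∈ s with ∀ b : P, b • a = a, f a ∈ integralMultiples p := by
  rw [← Finset.sum_filter_add_sum_filter_not s (fun a ↦ ∀ b : P, b • a = a), add_sub_cancel_left,
    Finset.sum_comp (fun x ↦ x) f]
  refine AddSubgroup.sum_mem _ fun v hv ↦ ?_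
  obtain ⟨a, ha, rfl⟩ := Finset.mem_image.1 hv
  have hai := hint a (Finset.mem_filter.1 ha).1
  rw [nsmul_eq_mul, mul_comm]
  refine mul_mem_integralMultiples hai
    ((natCast_mem_integralMultiples (Fact.out : p.Prime).ne_zero).2 ?_)
  set t := {x ∈ s.filter (fun a ↦ ¬ ∀ b : P, b • a = a) | f x = f a} with ht
  have hmem : ∀ x, x ∈ t ↔ (x ∈ s ∧ ¬ ∀ b : P, b • x = x) ∧ f x = f a := by simp [ht]
  let T : SubMulAction P α :=
    { carrier := t
      smul_mem' := by
        intro b x hx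
        simp only [Finset.mem_coe, hmem] at hx ⊢
        refine ⟨⟨hs b x hx.1.1, fun h ↦ hx.1.2 ?_⟩, by rw [hf b x hx.1.1, hx.2]⟩
        have hbx : b • x = x := by simpa using (h b⁻¹).symm
        rwa [hbx] at h }
  have : Finite T := t.finite_toSet
  have hcard := hP.card_modEq_card_fixedPoints T
  have h0 : Nat.card (MulAction.fixedPoints P T) = 0 := by
    rw [Nat.card_eq_zero]
    left
    refine ⟨fun x ↦ ((hmem x.1.1).1 x.1.2).1.2 fun b ↦ ?_⟩
    exact congr_arg Subtype.val (x.2 b)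
  have hT : Nat.card T = t.card := Nat.card_eq_card_toFinset (t : Set α) |>.trans (by simp)
  rw [h0, hT] at hcard
  exact Nat.modEq_zero_iff_dvd.1 hcard

end Congruence

section Action

variable {P G : Type} [Group P] [Group G]

/-- Invariance of a function under the action of `P` on `G`. -/
def IsInvariantFun (σ : P →* MulAut G) (χ : G → ℂ) : Prop :=
  ∀ b g, χ (σ b g) = χ g

/-- Restriction of an action to an invariant subgroup. -/
def restrictAction (σ : P →* MulAut G) (H : Subgroup G) (hH : ∀ b, ∀ g ∈ H, σ b g ∈ H) :
    P →* MulAut H where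
  toFun b :=
    { toFun := fun h ↦ ⟨σ b h, hH b h h.2⟩
      invFun := fun h ↦ ⟨σ b⁻¹ h, hH b⁻¹ h h.2⟩
      left_inv := fun h ↦ by simp [map_inv]
      right_inv := fun h ↦ by simp [map_inv]
      map_mul' := fun h k ↦ by ext; simp }
  map_one' := by ext; simp
  map_mul' := fun b c ↦ by ext; simp

/-- The action of `P` on functions induced by its action on `G`. -/
abbrev functionAction (σ : P →* MulAut G) : MulAction P (G → ℂ) where
  smul b F := fun g ↦ F (σ b⁻¹ g)
  one_smul F := by
    change (fun g ↦ F (σ 1⁻¹ g)) = F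
    simp
  mul_smul b c F := by
    change (fun g ↦ F (σ (b * c)⁻¹ g)) = fun g ↦ F (σ c⁻¹ (σ b⁻¹ g))
    simp

lemma IsInvariantFun.restrict {σ : P →* MulAut G} {H : Subgroup G} {hH : ∀ b, ∀ g ∈ H, σ b g ∈ H}
    {χ : G → ℂ} (hχ : IsInvariantFun σ χ) :
    IsInvariantFun (restrictAction σ H hH) (fun h ↦ χ h) :=
  fun b h ↦ hχ b h

lemma IsInvariantFun.mul_conj {σ : P →* MulAut G} {χ χ' : G → ℂ} (hχ : IsInvariantFun σ χ)
    (hχ' : IsInvariantFun σ χ') :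
    IsInvariantFun σ (fun g ↦ χ g * (starRingEnd ℂ) (χ' g)) :=
  fun b g ↦ by simp only [hχ b g, hχ' b g]

/-- The extension by zero of a function on a subgroup. -/
noncomputable def extendByZero {H : Subgroup G} (φ : H → ℂ) (g : G) : ℂ :=
  if hg : g ∈ H then φ ⟨g, hg⟩ else 0

lemma extendByZero_coe {H : Subgroup G} (φ : H → ℂ) (h : H) : extendByZero φ (h : G) = φ h := by
  simp [extendByZero]

variable [Fintype G] {p : ℕ} [Fact p.Prime]

lemma sum_sub_sum_centralizer_mem (hP : IsPGroup p P) (σ : P →* MulAut G) {f : G → ℂ}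
    (hf : IsInvariantFun σ f) (hint : ∀ g, IsIntegral ℤ (f g)) :
    ∑ g, f g - ∑ g with ∀ b, σ b g = g, f g ∈ integralMultiples p := by
  let := MulAction.compHom G σ
  exact hP.sum_sub_sum_fixed_mem Finset.univ (fun _ _ _ ↦ Finset.mem_univ _) (fun b g _ ↦ hf b g)
    fun g _ ↦ hint g

lemma sum_irrChars_sub_sum_invariant_mem (hP : IsPGroup p P) (σ : P →* MulAut G)
    {f : (G → ℂ) → ℂ} (hf : ∀ φ, IsIrrChar G φ → ∀ b, f (fun g ↦ φ (σ b g)) = f φ)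
    (hint : ∀ φ, IsIrrChar G φ → IsIntegral ℤ (f φ)) :
    ∑ φ ∈ irrChars G, f φ - ∑ φ ∈ irrChars G with IsInvariantFun σ φ, f φ ∈ integralMultiples p := by
  let := functionAction σ
  convert hP.sum_sub_sum_fixed_mem (irrChars G) (f := f) ?_ ?_ ?_ using 4 with φ
  · constructor
    · intro h b
      ext g
      exact h b⁻¹ g
    · intro h b g
      have := congr_fun (h b⁻¹) g
      change φ (σ b⁻¹⁻¹ g) = φ g at this
      rwa [inv_inv] at this
  · intro b φ hφ
    rw [mem_irrChars] at hφ ⊢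
    exact hφ.comp_mulEquiv (σ b⁻¹)
  · intro b φ hφ
    exact hf φ (mem_irrChars.1 hφ) b⁻¹
  · exact fun φ hφ ↦ hint φ (mem_irrChars.1 hφ)

end Action

section Correspondence

variable {p : ℕ} [Fact p.Prime] {P G : Type} [Group P] [Group G] [Fintype G]
  {σ : P →* MulAut G} {H : Subgroup G} {hH : ∀ b, ∀ g ∈ H, σ b g ∈ H}

lemma sum_centralizer_restrictAction (hC : ∀ g, (∀ b, σ b g = g) → g ∈ H) (f : G → ℂ) :
    ∑ h : H with ∀ b, restrictAction σ H hH b h = h, f h = ∑ g with ∀ b, σ b g = g, f g := by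
  refine Finset.sum_bij (fun h _ ↦ (h : G)) ?_ ?_ ?_ ?_
  · intro h hh
    simp only [Finset.mem_filter, Finset.mem_univ, true_and] at hh ⊢
    exact fun b ↦ congr_arg Subtype.val (hh b)
  · exact fun _ _ _ _ h ↦ Subtype.ext h
  · intro g hg
    simp only [Finset.mem_filter, Finset.mem_univ, true_and] at hg
    exact ⟨⟨g, hC g hg⟩, by simpa using fun b ↦ Subtype.ext (hg b), rfl⟩
  · exact fun _ _ ↦ rfl

lemma card_mul_innerChar (α β : G → ℂ) :
    (Fintype.card G : ℂ) * innerChar G α β = ∑ g, α g * (starRingEnd ℂ) (β g) := by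
  rw [innerChar, mul_inv_cancel_left₀ (by simp)]

lemma IsChar.restrict {χ : G → ℂ} (hχ : IsChar G χ) (H : Subgroup G) :
    IsChar H (fun h ↦ χ h) :=
  hχ.comp H.subtype

lemma IsChar.isIntegral_mul_conj {χ χ' : G → ℂ} (hχ : IsChar G χ) (hχ' : IsChar G χ') (g : G) :
    IsIntegral ℤ (χ g * (starRingEnd ℂ) (χ' g)) := by
  rw [← hχ'.apply_inv]
  exact (hχ.isIntegral g).mul (hχ'.isIntegral _)

lemma IsChar.isIntegral_innerChar {χ χ' : G → ℂ} (hχ : IsChar G χ) (hχ' : IsChar G χ') :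
    IsIntegral ℤ (innerChar G χ χ') := by
  obtain ⟨m, hm⟩ := hχ.exists_natCast_innerChar hχ'
  rw [hm]
  exact isIntegral_natCast m

/-- The inner product of two invariant characters of `G` is congruent modulo `p`, up to the group
orders, to the contribution of the invariant irreducible characters of `H` to the inner product of
the restrictions. -/
lemma card_mul_innerChar_sub_mem (hP : IsPGroup p P) (hC : ∀ g, (∀ b, σ b g = g) → g ∈ H)
    {χ χ' : G → ℂ} (hχ : IsChar G χ) (hχ' : IsChar G χ') (hχσ : IsInvariantFun σ χ)
    (hχσ' : IsInvariantFun σ χ') :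
    (Fintype.card G : ℂ) * innerChar G χ χ' - (Fintype.card H : ℂ) *
      ∑ φ ∈ irrChars H with IsInvariantFun (restrictAction σ H hH) φ,
        innerChar H (fun h ↦ χ h) φ * innerChar H φ (fun h ↦ χ' h) ∈ integralMultiples p := by
  have h1 := sum_sub_sum_centralizer_mem hP σ (hχσ.mul_conj hχσ') (hχ.isIntegral_mul_conj hχ')
  have h2 := sum_sub_sum_centralizer_mem hP (restrictAction σ H hH)
    (hχσ.restrict.mul_conj hχσ'.restrict)
    ((hχ.restrict H).isIntegral_mul_conj (hχ'.restrict H))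
  have h3 := mul_mem_integralMultiples (isIntegral_natCast (Fintype.card H)) <|
    sum_irrChars_sub_sum_invariant_mem hP (restrictAction σ H hH)
      (f := fun φ ↦ innerChar H (fun h ↦ χ h) φ * innerChar H φ (fun h ↦ χ' h))
      (fun φ _ b ↦ by
        rw [← innerChar_comp_mulEquiv (restrictAction σ H hH b) _ φ,
          ← innerChar_comp_mulEquiv (restrictAction σ H hH b) φ]
        congr 2
        · ext h; exact (hχσ b h).symm
        · ext h; exact (hχσ' b h).symm)
      (fun φ hφ ↦ ((hχ.restrict H).isIntegral_innerChar hφ.1).mul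
        (hφ.1.isIntegral_innerChar (hχ'.restrict H)))
  rw [← card_mul_innerChar] at h1 h2
  rw [sum_centralizer_restrictAction hC (fun g ↦ χ g * (starRingEnd ℂ) (χ' g))] at h2
  rw [← innerChar_eq_sum_mul (hχ.restrict H).apply_conj] at h3
  convert add_mem (sub_mem h1 h2) h3 using 1
  ring

/-- An invariant irreducible character of `G` has an invariant irreducible constituent on `H` with
multiplicity prime to `p`. -/
lemma exists_constituent_restrict (hP : IsPGroup p P) (hpG : ¬ p ∣ Fintype.card G)
    (hC : ∀ g, (∀ b, σ b g = g) → g ∈ H) {χ : G → ℂ} (hχ : IsIrrChar G χ)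
    (hχσ : IsInvariantFun σ χ) :
    ∃ φ, IsIrrChar H φ ∧ IsInvariantFun (restrictAction σ H hH) φ ∧
      ∃ m : ℕ, innerChar H (fun h ↦ χ h) φ = m ∧ ¬ p ∣ m := by
  have hp0 : p ≠ 0 := (Fact.out : p.Prime).ne_zero
  by_contra! hcon
  have h := card_mul_innerChar_sub_mem (hH := hH) hP hC hχ.1 hχ.1 hχσ hχσ
  refine hpG ((natCast_mem_integralMultiples hp0).1 ?_)
  rw [hχ.2, mul_one] at h
  refine mem_integralMultiples_of_sub h ?_
  refine mul_mem_integralMultiples (isIntegral_natCast _) (AddSubgroup.sum_mem _ fun φ hφ ↦ ?_)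
  obtain ⟨hφ, hφσ⟩ := Finset.mem_filter.1 hφ
  rw [mem_irrChars] at hφ
  obtain ⟨m, hm⟩ := (hχ.1.restrict H).exists_natCast_innerChar hφ.1
  rw [mul_comm]
  refine mul_mem_integralMultiples (hφ.1.isIntegral_innerChar (hχ.1.restrict H)) ?_
  rw [hm, natCast_mem_integralMultiples hp0]
  exact hcon φ hφ hφσ m hm

/-- If `ψ` is the only invariant irreducible constituent of `χ` on `H` with multiplicity prime to
`p`, then no other invariant irreducible character of `G` contains `ψ` with multiplicity prime to
`p`. -/
lemma eq_of_unique_constituent (hP : IsPGroup p P) (hpG : ¬ p ∣ Fintype.card G)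
    (hC : ∀ g, (∀ b, σ b g = g) → g ∈ H) {χ χ' : G → ℂ} (hχ : IsIrrChar G χ)
    (hχ' : IsIrrChar G χ') (hχσ : IsInvariantFun σ χ) (hχσ' : IsInvariantFun σ χ')
    {ψ : H → ℂ} (hψ : IsIrrChar H ψ) (hψσ : IsInvariantFun (restrictAction σ H hH) ψ)
    (hmult : ∃ m : ℕ, innerChar H (fun h ↦ χ h) ψ = m ∧ ¬ p ∣ m)
    (huniq : ∀ φ, IsIrrChar H φ → IsInvariantFun (restrictAction σ H hH) φ →
      (∃ m : ℕ, innerChar H (fun h ↦ χ h) φ = m ∧ ¬ p ∣ m) → φ = ψ)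
    (hmult' : ∃ m : ℕ, innerChar H (fun h ↦ χ' h) ψ = m ∧ ¬ p ∣ m) : χ' = χ := by
  have hp : p.Prime := Fact.out
  obtain ⟨m, hm, hpm⟩ := hmult
  obtain ⟨m', hm', hpm'⟩ := hmult'
  by_contra hne
  have h := card_mul_innerChar_sub_mem (hH := hH) hP hC hχ.1 hχ'.1 hχσ hχσ'
  rw [hχ.innerChar_eq_zero hχ' (Ne.symm hne), mul_zero, zero_sub, neg_mem_iff,
    ← Finset.add_sum_erase _ _ (Finset.mem_filter.2 ⟨mem_irrChars.2 hψ, hψσ⟩), mul_add] at h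
  have hrest := (AddSubgroup.add_mem_cancel_right _ ?_).1 h
  · rw [hm, hψ.1.innerChar_comm (hχ'.1.restrict H), hm'] at hrest
    have hdvd : p ∣ Fintype.card H * (m * m') :=
      (natCast_mem_integralMultiples hp.ne_zero).1 (by exact_mod_cast hrest)
    have hpH : ¬ p ∣ Fintype.card H := fun hd ↦ hpG <| hd.trans <| by
      simpa only [Nat.card_eq_fintype_card] using H.card_subgroup_dvd_card
    rcases hp.dvd_mul.1 hdvd with hd | hd
    · exact hpH hd
    · exact (hp.dvd_mul.1 hd).elim hpm hpm'
  · refine mul_mem_integralMultiples (isIntegral_natCast _) (AddSubgroup.sum_mem _ fun φ hφ ↦ ?_)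
    obtain ⟨hφψ, hφ⟩ := Finset.mem_erase.1 hφ
    obtain ⟨hφ, hφσ⟩ := Finset.mem_filter.1 hφ
    rw [mem_irrChars] at hφ
    obtain ⟨k, hk⟩ := (hχ.1.restrict H).exists_natCast_innerChar hφ.1
    rw [mul_comm]
    refine mul_mem_integralMultiples (hφ.1.isIntegral_innerChar (hχ'.1.restrict H)) ?_
    rw [hk, natCast_mem_integralMultiples hp.ne_zero]
    by_contra hpk
    exact hφψ (huniq φ hφ hφσ ⟨k, hk, hpk⟩)

/-- The character induced from `H`, multiplied by the order of `H`. -/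
noncomputable def inducedSum (φ : H → ℂ) (g : G) : ℂ :=
  ∑ x : G, extendByZero φ (x * g * x⁻¹)

lemma inducedSum_conj (φ : H → ℂ) (g h : G) : inducedSum φ (h * g * h⁻¹) = inducedSum φ g := by
  refine Fintype.sum_equiv (Equiv.mulRight h) _ _ fun x ↦ ?_
  simp [mul_assoc]

/-- Frobenius reciprocity. -/
lemma innerChar_inducedSum (φ : H → ℂ) {χ : G → ℂ} (hχ : IsChar G χ) :
    innerChar G (inducedSum φ) χ = Fintype.card H * innerChar H φ (fun h ↦ χ h) := by
  have hsum : ∀ x : G, ∑ g, extendByZero φ (x * g * x⁻¹) * (starRingEnd ℂ) (χ g) =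
      ∑ h : H, φ h * (starRingEnd ℂ) (χ h) := by
    intro x
    have h1 : ∑ g, extendByZero φ (x * g * x⁻¹) * (starRingEnd ℂ) (χ g) =
        ∑ g, extendByZero φ g * (starRingEnd ℂ) (χ g) := by
      refine Fintype.sum_equiv (MulAut.conj x).toEquiv _ _ fun g ↦ ?_
      simp [hχ.apply_conj]
    rw [h1]
    refine (Finset.sum_of_injOn Subtype.val Subtype.val_injective.injOn (by simp) ?_ ?_).symm
    · intro g _ hg
      have hgH : g ∉ H := by simpa using hg
      simp [extendByZero, hgH]
    · simp [extendByZero_coe]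
  rw [card_mul_innerChar, innerChar]
  simp_rw [inducedSum, Finset.sum_mul]
  rw [Finset.sum_comm]
  simp_rw [hsum]
  simp

/-- An invariant irreducible character of `H` lies, with multiplicity prime to `p`, under an
invariant irreducible character of `G`. -/
lemma exists_constituent_induced (hP : IsPGroup p P) (hpG : ¬ p ∣ Fintype.card G)
    (hC : ∀ g, (∀ b, σ b g = g) → g ∈ H) {φ : H → ℂ} (hφ : IsIrrChar H φ)
    (hφσ : IsInvariantFun (restrictAction σ H hH) φ) :
    ∃ χ, IsIrrChar G χ ∧ IsInvariantFun σ χ ∧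
      ∃ m : ℕ, innerChar H (fun h ↦ χ h) φ = m ∧ ¬ p ∣ m := by
  have hp : p.Prime := Fact.out
  by_contra! hcon
  have hpH : ¬ p ∣ Fintype.card H := fun hd ↦ hpG <| hd.trans <| by
    simpa only [Nat.card_eq_fintype_card] using H.card_subgroup_dvd_card
  set C : Finset H := {h | ∀ b, restrictAction σ H hH b h = h} with hCdef
  have hind : ∀ c ∈ C, inducedSum φ (c : G) ∈ integralMultiples p := by
    intro c hc
    have hcσ : ∀ b, σ b c = c := fun b ↦
      congr_arg Subtype.val ((Finset.mem_filter.1 hc).2 b)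
    have h := sum_irrChars_sub_sum_invariant_mem hP σ
      (f := fun χ ↦ innerChar H φ (fun h ↦ χ h) * χ c)
      (fun χ _ b ↦ by
        simp only [hcσ]
        rw [← innerChar_comp_mulEquiv (restrictAction σ H hH b) φ (fun h ↦ χ h)]
        congr 2
        ext h; exact (hφσ b h).symm)
      (fun χ hχ ↦ (hφ.1.isIntegral_innerChar (hχ.1.restrict H)).mul (hχ.1.isIntegral _))
    rw [eq_sum_innerChar_mul (inducedSum_conj φ)]
    have hfrob : ∑ χ ∈ irrChars G, innerChar G (inducedSum φ) χ * χ c =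
        Fintype.card H * ∑ χ ∈ irrChars G, innerChar H φ (fun h ↦ χ h) * χ c := by
      rw [Finset.mul_sum]
      refine Finset.sum_congr rfl fun χ hχ ↦ ?_
      rw [innerChar_inducedSum φ (mem_irrChars.1 hχ).1, mul_assoc]
    rw [hfrob]
    refine mul_mem_integralMultiples (isIntegral_natCast _)
      (mem_integralMultiples_of_sub h (AddSubgroup.sum_mem _ fun χ hχ ↦ ?_))
    obtain ⟨hχ, hχσ⟩ := Finset.mem_filter.1 hχ
    rw [mem_irrChars] at hχ
    obtain ⟨m, hm⟩ := (hχ.1.restrict H).exists_natCast_innerChar hφ.1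
    rw [mul_comm]
    refine mul_mem_integralMultiples (hχ.1.isIntegral _) ?_
    rw [hφ.1.innerChar_comm (hχ.1.restrict H), hm, natCast_mem_integralMultiples hp.ne_zero]
    exact hcon χ hχ hχσ m hm
  have hmackey : ∀ c ∈ C, inducedSum φ (c : G) - C.card * φ c ∈ integralMultiples p := by
    intro c hc
    have hcσ : ∀ b, σ b c = c := fun b ↦
      congr_arg Subtype.val ((Finset.mem_filter.1 hc).2 b)
    have h := sum_sub_sum_centralizer_mem hP σ (f := fun x ↦ extendByZero φ (x * c * x⁻¹))
      (fun b x ↦ by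
        have h1 : σ b x * c * (σ b x)⁻¹ = σ b (x * c * x⁻¹) := by simp [hcσ]
        simp only [h1]
        by_cases hx : x * c * x⁻¹ ∈ H
        · simp only [extendByZero, dif_pos hx, dif_pos (hH b _ hx)]
          exact hφσ b ⟨_, hx⟩
        · have hx' : σ b (x * c * x⁻¹) ∉ H := fun h ↦ hx (by simpa using hH b⁻¹ _ h)
          simp only [extendByZero, dif_neg hx, dif_neg hx'])
      (fun x ↦ by
        simp only [extendByZero]
        split_ifs
        exacts [hφ.1.isIntegral _, isIntegral_zero])
    rw [← sum_centralizer_restrictAction (hH := hH) hC] at h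
    convert h using 2
    · rfl
    · rw [← nsmul_eq_mul]
      refine (Finset.sum_eq_card_nsmul fun x _ ↦ ?_).symm
      rw [← hφ.1.apply_conj c x, ← extendByZero_coe φ]
      rfl
  have hφC : ∀ c ∈ C, (C.card : ℂ) * φ c ∈ integralMultiples p := fun c hc ↦ by
    simpa using sub_mem (hind c hc) (hmackey c hc)
  have hnorm := sum_sub_sum_centralizer_mem hP (restrictAction σ H hH) (hφσ.mul_conj hφσ)
    (hφ.1.isIntegral_mul_conj hφ.1)
  rw [← card_mul_innerChar, hφ.2, mul_one, ← hCdef] at hnorm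
  have hcardC := sum_sub_sum_centralizer_mem hP (restrictAction σ H hH) (f := fun _ ↦ 1)
    (fun _ _ ↦ rfl) (fun _ ↦ isIntegral_one)
  rw [← hCdef] at hcardC
  simp only [Finset.sum_const, Finset.card_univ, nsmul_eq_mul, mul_one] at hcardC
  have hCH : (C.card : ℂ) * Fintype.card H ∈ integralMultiples p := by
    have h1 := mul_mem_integralMultiples (isIntegral_natCast C.card) hnorm
    rw [mul_sub] at h1
    refine mem_integralMultiples_of_sub h1 ?_
    rw [Finset.mul_sum]
    refine AddSubgroup.sum_mem _ fun c hc ↦ ?_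
    rw [← hφ.1.apply_inv, ← mul_assoc, mul_comm]
    exact mul_mem_integralMultiples (hφ.1.isIntegral _) (hφC c hc)
  have hHH : ((Fintype.card H * Fintype.card H : ℕ) : ℂ) ∈ integralMultiples p := by
    have h1 := add_mem (mul_mem_integralMultiples (isIntegral_natCast (Fintype.card H)) hcardC) hCH
    convert h1 using 1
    push_cast
    ring
  rw [natCast_mem_integralMultiples hp.ne_zero, hp.dvd_mul, or_self] at hHH
  exact hpH hHH

end Correspondence

section Subnormal

variable {p : ℕ} {A : Type*} [Group A]

lemma normalIn.le_normalizer {N X : Subgroup A} (h : normalIn N X) :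
    X ≤ Subgroup.normalizer (N : Set A) := by
  intro x hx
  rw [Subgroup.mem_normalizer_iff]
  refine fun n ↦ ⟨h.2 x hx n, fun hn ↦ ?_⟩
  simpa [mul_assoc] using h.2 x⁻¹ (inv_mem hx) _ hn

lemma normalIn.inf {N X : Subgroup A} (h : normalIn N X) (T : Subgroup A) :
    normalIn (N ⊓ T) (X ⊓ T) :=
  ⟨inf_le_inf_right T h.1, fun x hx n hn ↦
    ⟨h.2 x hx.1 n hn.1, T.mul_mem (T.mul_mem hx.2 hn.2) (T.inv_mem hx.2)⟩⟩

lemma normalIn.sup {M N X : Subgroup A} (hM : normalIn M X) (hN : normalIn N X) :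
    normalIn (M ⊔ N) X := by
  refine ⟨sup_le hM.1 hN.1, fun x hx ↦ ?_⟩
  change M ⊔ N ≤ (M ⊔ N).comap (MulAut.conj x).toMonoidHom
  exact sup_le (fun m hm ↦ Subgroup.mem_sup_left (hM.2 x hx m hm))
    fun n hn ↦ Subgroup.mem_sup_right (hN.2 x hx n hn)

lemma normalIn.map_conj {N X : Subgroup A} (hN : normalIn N X) {y : A}
    (hy : ∀ x ∈ X, y * x * y⁻¹ ∈ X) (hy' : ∀ x ∈ X, y⁻¹ * x * y ∈ X) :
    normalIn (N.map (MulAut.conj y).toMonoidHom) X := by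
  constructor
  · rintro _ ⟨n, hn, rfl⟩
    exact hy n (hN.1 hn)
  · rintro x hx _ ⟨n, hn, rfl⟩
    refine ⟨_, hN.2 _ (hy' x hx) n hn, ?_⟩
    simp [mul_assoc]

/-- A normal `p`-subgroup of a normal subgroup `X` of `Y` lies in a `p`-subgroup of `X` that is
normal in `Y`. -/
lemma normalIn.exists_isPGroup_normalIn [Finite A] {K X Y : Subgroup A} (hK : IsPGroup p K)
    (hKX : normalIn K X) (hXY : normalIn X Y) :
    ∃ L : Subgroup A, IsPGroup p L ∧ K ≤ L ∧ normalIn L Y := by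
  obtain ⟨L, hKL, ⟨hL, hLX⟩, hmax⟩ :=
    (Set.toFinite {N : Subgroup A | IsPGroup p N ∧ normalIn N X}).exists_le_maximal ⟨hK, hKX⟩
  refine ⟨L, hL, hKL, hLX.1.trans hXY.1, fun y hy n hn ↦ ?_⟩
  have hLy : normalIn (L.map (MulAut.conj y).toMonoidHom) X :=
    hLX.map_conj (hXY.2 y hy) fun x hx ↦ by simpa using hXY.2 y⁻¹ (inv_mem hy) x hx
  exact hmax ⟨hL.to_sup_of_normal_right' (hL.map _) (hLX.1.trans hLy.le_normalizer), hLX.sup hLy⟩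
    le_sup_left (Subgroup.mem_sup_right ⟨n, hn, rfl⟩)

/-- A subnormal `p`-subgroup lies in a normal `p`-subgroup of any subgroup containing it. -/
lemma subnormalIn.exists_isPGroup_normalIn [Finite A] {B T : Subgroup A} (hB : IsPGroup p B)
    (hsub : subnormalIn B (⊤ : Subgroup A)) (hBT : B ≤ T) :
    ∃ P : Subgroup A, IsPGroup p P ∧ B ≤ P ∧ normalIn P T := by
  obtain ⟨n, f, h0, hn, hf⟩ := hsub
  have key : ∀ i : Fin (n + 1), ∃ P : Subgroup A, IsPGroup p P ∧ B ≤ P ∧ normalIn P (f i ⊓ T) := by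
    intro i
    induction i using Fin.induction with
    | zero =>
      rw [h0, inf_of_le_left hBT]
      exact ⟨B, hB, le_rfl, le_rfl, fun b hb c hc ↦ mul_mem (mul_mem hb hc) (inv_mem hb)⟩
    | succ i ih =>
      obtain ⟨P, hP, hBP, hPX⟩ := ih
      obtain ⟨L, hL, hPL, hLY⟩ := hPX.exists_isPGroup_normalIn hP ((hf i).inf T)
      exact ⟨L, hL, hBP.trans hPL, hLY⟩
  simpa [hn] using key (Fin.last n)

end Subnormal

section Stabilizer

variable {A G : Type} [Group A] [Group G]

/-- The stabilizer of a function on `G` under an action on `G`. -/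
def functionStabilizer (ρ : A →* MulAut G) (χ : G → ℂ) : Subgroup A where
  carrier := {a | ∀ g, χ (ρ a g) = χ g}
  one_mem' := by simp
  mul_mem' := fun {a b} ha hb g ↦ by rw [map_mul, MulAut.mul_apply, ha, hb]
  inv_mem' := fun {a} ha g ↦ by rw [← ha, ← MulAut.mul_apply, ← map_mul]; simp

/-- Twisting by an element normalizing `P` preserves invariance under `P`. -/
lemma IsInvariantFun.comp_of_normalIn {ρ : A →* MulAut G} {P T : Subgroup A} {χ : G → ℂ}
    (hχ : IsInvariantFun (ρ.comp P.subtype) χ) (hPT : normalIn P T) {a : A} (ha : a ∈ T) :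
    IsInvariantFun (ρ.comp P.subtype) (fun g ↦ χ (ρ a g)) := fun b g ↦ by
  have h := hχ ⟨a * b * a⁻¹, hPT.2 a ha b b.2⟩ (ρ a g)
  simpa [← MulAut.mul_apply, ← map_mul] using h

end Stabilizer

theorem stmt_11 {G A : Type} [Group G] [Fintype G] [Group A] [Fintype A]
    (p : ℕ) (hp : p.Prime) (hpG : ¬ p ∣ Fintype.card G)
    (ρ : A →* MulAut G)
    (B : Subgroup A) (hB : IsPGroup p ↥B) (hBsub : subnormalIn B (⊤ : Subgroup A))
    (H : Subgroup G)
    (hCH : ∀ g : G, (∀ b : ↥B, ρ ↑b g = g) → g ∈ H)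
    (hHinv : ∀ a : A, ∀ g ∈ H, ρ a g ∈ H)
    (χ : G → ℂ) (hχ : IsIrrChar G χ)
    (hχB : ∀ b : ↥B, ∀ g : G, χ (ρ ↑b g) = χ g)
    (ψ : ↥H → ℂ) (hψ : IsIrrChar ↥H ψ)
    (hψB : ∀ b : ↥B, ∀ h : ↥H, ψ ⟨ρ ↑b ↑h, hHinv ↑b ↑h h.2⟩ = ψ h)
    (hmult : ∃ m : ℕ, innerChar ↥H (fun h => χ ↑h) ψ = m ∧ ¬ p ∣ m)
    (huniq : ∀ ψ' : ↥H → ℂ, IsIrrChar ↥H ψ' →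
      (∀ b : ↥B, ∀ h : ↥H, ψ' ⟨ρ ↑b ↑h, hHinv ↑b ↑h h.2⟩ = ψ' h) →
      (∃ m : ℕ, innerChar ↥H (fun h => χ ↑h) ψ' = m ∧ ¬ p ∣ m) → ψ' = ψ) :
    ∀ a : A, (∀ g : G, χ (ρ a g) = χ g) ↔
      (∀ h : ↥H, ψ ⟨ρ a ↑h, hHinv a ↑h h.2⟩ = ψ h) := by
  have : Fact p.Prime := ⟨hp⟩
  intro a
  have hχB' : IsInvariantFun (ρ.comp B.subtype) χ := hχB
  constructor
  · intro ha
    obtain ⟨P, hP, hBP, hPT⟩ := hBsub.exists_isPGroup_normalIn hB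
      (T := functionStabilizer ρ χ) fun b hb ↦ hχB ⟨b, hb⟩
    obtain ⟨φ, hφ, hφP, hφm⟩ := exists_constituent_restrict
      (σ := ρ.comp P.subtype) (hH := fun b ↦ hHinv b) hP hpG
      (fun g hg ↦ hCH g fun b ↦ hg ⟨b, hBP b.2⟩) hχ fun b ↦ hPT.1 b.2
    obtain rfl : φ = ψ := huniq φ hφ (fun b ↦ hφP ⟨b, hBP b.2⟩) hφm
    have hφa : IsInvariantFun ((restrictAction ρ H hHinv).comp P.subtype)
        (fun h ↦ φ (restrictAction ρ H hHinv a h)) :=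
      IsInvariantFun.comp_of_normalIn (P := P) (ρ := restrictAction ρ H hHinv) hφP hPT ha
    refine congr_fun (huniq _ (hφ.comp_mulEquiv (restrictAction ρ H hHinv a))
      (fun b ↦ hφa ⟨b, hBP b.2⟩) ?_)
    obtain ⟨m, hm, hpm⟩ := hφm
    refine ⟨m, ?_, hpm⟩
    rw [← hm, ← innerChar_comp_mulEquiv (restrictAction ρ H hHinv a) (fun h ↦ χ h) φ]
    congr 1
    ext h
    exact (ha h).symm
  · intro ha
    obtain ⟨P, hP, hBP, hPT⟩ := hBsub.exists_isPGroup_normalIn hB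
      (T := functionStabilizer (restrictAction ρ H hHinv) ψ) fun b hb ↦ hψB ⟨b, hb⟩
    obtain ⟨χ', hχ', hχP, hχm⟩ := exists_constituent_induced
      (σ := ρ.comp P.subtype) (hH := fun b ↦ hHinv b) hP hpG
      (fun g hg ↦ hCH g fun b ↦ hg ⟨b, hBP b.2⟩) hψ fun b ↦ hPT.1 b.2
    have huniq' : ∀ χ' : G → ℂ, IsIrrChar G χ' → IsInvariantFun (ρ.comp P.subtype) χ' →
        (∃ m : ℕ, innerChar H (fun h ↦ χ' h) ψ = m ∧ ¬ p ∣ m) → χ' = χ := fun χ' hχ' hχP hχm ↦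
      eq_of_unique_constituent (σ := ρ.comp B.subtype) (hH := fun b ↦ hHinv b) hB hpG hCH hχ hχ'
        hχB' (fun b ↦ hχP ⟨b, hBP b.2⟩) hψ hψB hmult huniq hχm
    obtain rfl := huniq' χ' hχ' hχP hχm
    refine congr_fun (huniq' _ (hχ.comp_mulEquiv (ρ a)) (hχP.comp_of_normalIn hPT ha) ?_)
    obtain ⟨m, hm, hpm⟩ := hχm
    refine ⟨m, ?_, hpm⟩
    rw [← hm, ← innerChar_comp_mulEquiv (restrictAction ρ H hHinv a) (fun h ↦ χ' h) ψ]
    congr 1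
    ext h
    exact (ha h).symm
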